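/- Let γ>1 and F0∈ℝ, and let ψ,u,ρ,p,v∥ be smooth functions of (t,R,φ,Z) on ℝ×{R>0}×ℝ×ℝ, 2π-periodic in φ, such that for every t the fields ψ,u,ρ,p,v∥ at time t are supported (in the (R,Z)-variables) in a fixed compact subset K of the half-plane {R>0}. Set w:=Δ_pol u, j:=Δ*ψ, ρ̂:=R²ρ, |B_pol|²:=((∂_Rψ)²+(∂_Zψ)²)/R², |B|²:=(F0²+(∂_Rψ)²+(∂_Zψ)²)/R². Assume the ideal (η=ν=0) reduced MHD system with parallel velocity holds pointwise: (i) ∂_tψ = R[ψ,u] − F0∂_φu; (ii) ∇·(ρ̂∇_pol∂_tu) − ∇·(ρ∂_t(v∥∇_polψ)) = (1/(2R))[R²|∇_polu|²,ρ̂] + (1/R)[ρ̂R²w,u] − (1/R)[R²,p] + (1/R)[ψ,j] − (F0/R²)∂_φj + (1/R)[ρv∥²j,ψ] + (1/R)[ρv∥(∇_polv∥·∇_polψ),ψ] − ∇·(ρ̂(F0/R²)v∥∇_pol(∂_φu)) + (1/R)[ρ̂,v∥(∇_polψ·∇_polu)] − (1/(2R))[ρ̂,v∥²|B_pol|²] −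 (1/R)[ρ̂v∥w,ψ] + (1/R)[u,ρ̂v∥j] + (1/R)[u,ρ̂(∇_polψ·∇_polv∥)] + (1/R)∂_Z(ρ̂(F0/R³)v∥∂_φ(v∥∂_Zψ)) + (1/R)∂_R(ρ̂(F0/R³)v∥∂_φ(v∥∂_Rψ)) − (1/R)∂_Z(ρ̂(F0²/R³)v∥²); (iii) ∂_tρ = R[ρ,u] + 2ρ∂_Zu − (v∥F0/R²)∂_φρ − (v∥/R)[ρ,ψ] − (ρ/R)[v∥,ψ] − (ρF0/R²)∂_φv∥; (iv) ∂_tp = R[p,u] + 2γp∂_Zu − (v∥F0/R²)∂_φp − (v∥/R)[p,ψ] − (γp/R)[v∥,ψ] − (γpF0/R²)∂_φv∥; (v) ρ|B|²∂_tv∥ + (ρv∥/R²)(∇_polψ·∇_pol∂_tψ) − ρ(∇_polψ·∇_pol∂_tu) = −(1/R)[p,ψ] − (F0/R²)∂_φp + (ρ/R)[ψ, v∥²|B|²/2] − (F0/R²)ρ∂_φ(v∥²|B|²/2) − (1/(2R))ρ[R²|∇_polu|²,ψ] − (ρ̂/R)w[ψ,u] − Rρ|B|²[u,v∥] − Rρv∥[u,|B|²/2]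 + Rρv∥[u,|B_pol|²/2] − ρv∥(j/R)[u,ψ] − (ρv∥/R)[ψ,(∇_polψ·∇_polu)] + (ρv∥F0/R²)(∇_polψ·∇_pol(∂_φu)) + ρv∥(F0²/R²)∂_Zu. Then, with energy density E := ((∂_Rψ)²+(∂_Zψ)²)/(2R²) + (ρ/2)( R²((∂_Ru)²+(∂_Zu)²) + v∥²|B|² − 2v∥(∇_polψ·∇_polu) ) + p/(γ−1), the total energy t ↦ ∫_0^{2π}∫_K E(t,R,φ,Z) R dR dZ dφ is constant in time. -/

import Mathlib

noncomputable section
set_option linter.unusedVariables false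

open Real

/-- Scalar fields as functions of `(t, R, φ, Z)`. -/
abbrev F4 := ℝ → ℝ → ℝ → ℝ → ℝ

/-- Partial derivative in time `t`. -/
def dT (f : F4) (t R φ Z : ℝ) : ℝ := deriv (fun s => f s R φ Z) t

/-- Partial derivative in `R`. -/
def dR (f : F4) (t R φ Z : ℝ) : ℝ := deriv (fun r => f t r φ Z) R

/-- Partial derivative in `φ`. -/
def dP (f : F4) (t R φ Z : ℝ) : ℝ := deriv (fun a => f t R a Z) φ

/-- Partial derivative in `Z`. -/
def dZ (f : F4) (t R φ Z : ℝ) : ℝ := deriv (fun z => f t R φ z) Z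

/-- Joint smoothness (C^∞) in `(t,R,φ,Z)`. -/
def Smooth4 (f : F4) : Prop :=
  ContDiff ℝ (⊤ : ℕ∞) fun q : ℝ × ℝ × ℝ × ℝ => f q.1 q.2.1 q.2.2.1 q.2.2.2

/-- Poisson bracket `[a,b] = ∂_R a ∂_Z b − ∂_Z a ∂_R b` (spatial). -/
def pb (a b : F4) (t R φ Z : ℝ) : ℝ :=
  dR a t R φ Z * dZ b t R φ Z - dZ a t R φ Z * dR b t R φ Z

/-- Grad–Shafranov operator `Δ* f = R ∂_R((1/R) ∂_R f) + ∂_ZZ f`. -/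
def GS (f : F4) (t R φ Z : ℝ) : ℝ :=
  R * dR (fun s r a z => (1 / r) * dR f s r a z) t R φ Z + dZ (dZ f) t R φ Z

/-- Poloidal Laplacian `Δ_pol f = (1/R) ∂_R(R ∂_R f) + ∂_ZZ f`. -/
def LapPol (f : F4) (t R φ Z : ℝ) : ℝ :=
  (1 / R) * dR (fun s r a z => r * dR f s r a z) t R φ Z + dZ (dZ f) t R φ Z

/-- Cylindrical divergence `∇·F = (1/R)∂_R(R F_R) + (1/R)∂_φ F_φ + ∂_Z F_Z`. -/
def divC (FR Fφ FZ : F4) (t R φ Z : ℝ) : ℝ :=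
  (1 / R) * dR (fun s r a z => r * FR s r a z) t R φ Z + (1 / R) * dP Fφ t R φ Z
    + dZ FZ t R φ Z

/-- Scalar advection `X·∇f = X_R ∂_R f + (X_φ/R) ∂_φ f + X_Z ∂_Z f`. -/
def advS (XvR XvP XvZ f : F4) (t R φ Z : ℝ) : ℝ :=
  XvR t R φ Z * dR f t R φ Z + XvP t R φ Z / R * dP f t R φ Z + XvZ t R φ Z * dZ f t R φ Z

/-- `e_R`-component of `B = (1/R)∇ψ×e_φ + (F0/R)e_φ`. -/
def BR (ψ : F4) : F4 := fun t R φ Z => (1 / R) * dZ ψ t R φ Z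

/-- `e_φ`-component of the magnetic field. -/
def BP (F0 : ℝ) : F4 := fun _ R _ _ => F0 / R

/-- `e_Z`-component of the magnetic field. -/
def BZ (ψ : F4) : F4 := fun t R φ Z => -(1 / R) * dR ψ t R φ Z

/-- `e_R`-component of `v_pol = −R∇u×e_φ`. -/
def vR (u : F4) : F4 := fun t R φ Z => -R * dZ u t R φ Z

/-- `e_Z`-component of `v_pol = −R∇u×e_φ`. -/
def vZ (u : F4) : F4 := fun t R φ Z => R * dR u t R φ Z

/-- The zero field. -/
def zeroF : F4 := fun _ _ _ _ => 0

/-- `∇_pol a · ∇_pol b`. -/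
def gdot (a b : F4) : F4 := fun t R φ Z =>
  dR a t R φ Z * dR b t R φ Z + dZ a t R φ Z * dZ b t R φ Z

/-- `|B|² = (F0² + (∂_Rψ)² + (∂_Zψ)²)/R²`. -/
def B2 (F0 : ℝ) (ψ : F4) : F4 := fun t R φ Z =>
  (F0 ^ 2 + (dR ψ t R φ Z) ^ 2 + (dZ ψ t R φ Z) ^ 2) / R ^ 2

/-- `|B_pol|² = ((∂_Rψ)² + (∂_Zψ)²)/R²`. -/
def Bpol2 (ψ : F4) : F4 := fun t R φ Z =>
  ((dR ψ t R φ Z) ^ 2 + (dZ ψ t R φ Z) ^ 2) / R ^ 2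

/-- `ρ̂ = R²ρ`. -/
def rh (ρ : F4) : F4 := fun t R φ Z => R ^ 2 * ρ t R φ Z

/-- `|∇_pol u|²`. -/
def gradu2 (u : F4) : F4 := fun t R φ Z => (dR u t R φ Z) ^ 2 + (dZ u t R φ Z) ^ 2

open MeasureTheory

/-- Reduced-MHD energy density
`E = |∇_polψ|²/(2R²) + (ρ/2)(R²|∇_pol u|² + v∥²|B|² − 2v∥ ∇_polψ·∇_pol u) + p/(γ−1)`. -/
def Edens (γ F0 : ℝ) (ψ u ρ p vpar : F4) : F4 := fun t R φ Z =>
  ((dR ψ t R φ Z) ^ 2 + (dZ ψ t R φ Z) ^ 2) / (2 * R ^ 2)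
    + ρ t R φ Z / 2 * (R ^ 2 * ((dR u t R φ Z) ^ 2 + (dZ u t R φ Z) ^ 2)
        + vpar t R φ Z ^ 2 * B2 F0 ψ t R φ Z
        - 2 * vpar t R φ Z * gdot ψ u t R φ Z)
    + p t R φ Z / (γ - 1)

/-- A field regarded as a function on `ℝ × ℝ × ℝ × ℝ`. -/
def unc (f : F4) (q : ℝ × ℝ × ℝ × ℝ) : ℝ := f q.1 q.2.1 q.2.2.1 q.2.2.2

/-- The region `R > 0`. -/
def posR : Set (ℝ × ℝ × ℝ × ℝ) := {q | 0 < q.2.1}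

lemma isOpen_posR : IsOpen posR :=
  isOpen_lt continuous_const (continuous_fst.comp continuous_snd)

/-- Fields that are smooth on `R > 0` and `2π`-periodic in `φ`. -/
structure Reg (f : F4) : Prop where
  smooth : ContDiffOn ℝ (⊤ : ℕ∞) (unc f) posR
  per : ∀ t R φ Z, f t R (φ + 2 * π) Z = f t R φ Z

/-- Regular fields vanishing off `K` in the `(R,Z)` variables. -/
structure Good (K : Set (ℝ × ℝ)) (f : F4) : Prop where
  reg : Reg f
  supp : ∀ t R φ Z, (R, Z) ∉ K → f t R φ Z = 0

section Derivatives

variable {f g : F4} {t R φ Z : ℝ}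

lemma hasFDerivAt_unc (hf : Reg f) (hR : 0 < R) :
    HasFDerivAt (unc f) (fderiv ℝ (unc f) (t, R, φ, Z)) (t, R, φ, Z) :=
  ((hf.smooth.contDiffAt (isOpen_posR.mem_nhds hR)).differentiableAt (by simp)).hasFDerivAt

lemma hasDerivAt_T (hf : Reg f) (hR : 0 < R) :
    HasDerivAt (fun s => f s R φ Z) (fderiv ℝ (unc f) (t, R, φ, Z) (1, 0, 0, 0)) t :=
  (hasFDerivAt_unc hf hR).comp_hasDerivAt t (f := fun s => (s, R, φ, Z))
    ((hasDerivAt_id t).prodMk ((hasDerivAt_const t R).prodMk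
      ((hasDerivAt_const t φ).prodMk (hasDerivAt_const t Z))))

lemma hasDerivAt_R (hf : Reg f) (hR : 0 < R) :
    HasDerivAt (fun r => f t r φ Z) (fderiv ℝ (unc f) (t, R, φ, Z) (0, 1, 0, 0)) R :=
  (hasFDerivAt_unc hf hR).comp_hasDerivAt R (f := fun r => (t, r, φ, Z))
    ((hasDerivAt_const R t).prodMk ((hasDerivAt_id R).prodMk
      ((hasDerivAt_const R φ).prodMk (hasDerivAt_const R Z))))

lemma hasDerivAt_P (hf : Reg f) (hR : 0 < R) :
    HasDerivAt (fun a => f t R a Z) (fderiv ℝ (unc f) (t, R, φ, Z) (0, 0, 1, 0)) φ :=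
  (hasFDerivAt_unc hf hR).comp_hasDerivAt φ (f := fun a => (t, R, a, Z))
    ((hasDerivAt_const φ t).prodMk ((hasDerivAt_const φ R).prodMk
      ((hasDerivAt_id φ).prodMk (hasDerivAt_const φ Z))))

lemma hasDerivAt_Z (hf : Reg f) (hR : 0 < R) :
    HasDerivAt (fun z => f t R φ z) (fderiv ℝ (unc f) (t, R, φ, Z) (0, 0, 0, 1)) Z :=
  (hasFDerivAt_unc hf hR).comp_hasDerivAt Z (f := fun z => (t, R, φ, z))
    ((hasDerivAt_const Z t).prodMk ((hasDerivAt_const Z R).prodMk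
      ((hasDerivAt_const Z φ).prodMk (hasDerivAt_id Z))))

lemma dT_spec (hf : Reg f) (hR : 0 < R) :
    HasDerivAt (fun s => f s R φ Z) (dT f t R φ Z) t :=
  (hasDerivAt_T hf hR).differentiableAt.hasDerivAt

lemma dR_spec (hf : Reg f) (hR : 0 < R) :
    HasDerivAt (fun r => f t r φ Z) (dR f t R φ Z) R :=
  (hasDerivAt_R hf hR).differentiableAt.hasDerivAt

lemma dP_spec (hf : Reg f) (hR : 0 < R) :
    HasDerivAt (fun a => f t R a Z) (dP f t R φ Z) φ :=
  (hasDerivAt_P hf hR).differentiableAt.hasDerivAt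

lemma dZ_spec (hf : Reg f) (hR : 0 < R) :
    HasDerivAt (fun z => f t R φ z) (dZ f t R φ Z) Z :=
  (hasDerivAt_Z hf hR).differentiableAt.hasDerivAt

lemma dT_mul (hf : Reg f) (hg : Reg g) (hR : 0 < R) :
    dT (fun s r a z => f s r a z * g s r a z) t R φ Z
      = dT f t R φ Z * g t R φ Z + f t R φ Z * dT g t R φ Z :=
  ((dT_spec hf hR).mul (dT_spec hg hR)).deriv

lemma dR_mul (hf : Reg f) (hg : Reg g) (hR : 0 < R) :
    dR (fun s r a z => f s r a z * g s r a z) t R φ Z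
      = dR f t R φ Z * g t R φ Z + f t R φ Z * dR g t R φ Z :=
  ((dR_spec hf hR).mul (dR_spec hg hR)).deriv

lemma dP_mul (hf : Reg f) (hg : Reg g) (hR : 0 < R) :
    dP (fun s r a z => f s r a z * g s r a z) t R φ Z
      = dP f t R φ Z * g t R φ Z + f t R φ Z * dP g t R φ Z :=
  ((dP_spec hf hR).mul (dP_spec hg hR)).deriv

lemma dZ_mul (hf : Reg f) (hg : Reg g) (hR : 0 < R) :
    dZ (fun s r a z => f s r a z * g s r a z) t R φ Z
      = dZ f t R φ Z * g t R φ Z + f t R φ Z * dZ g t R φ Z :=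
  ((dZ_spec hf hR).mul (dZ_spec hg hR)).deriv

end Derivatives

namespace Reg

variable {f g : F4}

lemma add (hf : Reg f) (hg : Reg g) : Reg fun t R φ Z => f t R φ Z + g t R φ Z :=
  ⟨hf.smooth.add hg.smooth, fun t R φ Z => by rw [hf.per, hg.per]⟩

lemma mul (hf : Reg f) (hg : Reg g) : Reg fun t R φ Z => f t R φ Z * g t R φ Z :=
  ⟨hf.smooth.mul hg.smooth, fun t R φ Z => by rw [hf.per, hg.per]⟩

lemma pow (hf : Reg f) (n : ℕ) : Reg fun t R φ Z => f t R φ Z ^ n :=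
  ⟨hf.smooth.pow n, fun t R φ Z => by rw [hf.per]⟩

lemma const (c : ℝ) : Reg fun _ _ _ _ => c :=
  ⟨contDiffOn_const, fun _ _ _ _ => rfl⟩

lemma sub (hf : Reg f) (hg : Reg g) : Reg fun t R φ Z => f t R φ Z - g t R φ Z :=
  ⟨hf.smooth.sub hg.smooth, fun t R φ Z => by rw [hf.per, hg.per]⟩

lemma radius : Reg fun _ R _ _ => R :=
  ⟨(contDiff_fst.comp contDiff_snd).contDiffOn, fun _ _ _ _ => rfl⟩

lemma div_radius_pow (hf : Reg f) (n : ℕ) : Reg fun t R φ Z => f t R φ Z / R ^ n :=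
  ⟨hf.smooth.div (radius.smooth.pow n) fun _ hq => pow_ne_zero n (ne_of_gt hq),
    fun t R φ Z => by rw [hf.per]⟩

lemma div_radius (hf : Reg f) : Reg fun t R φ Z => f t R φ Z / R := by
  simpa using hf.div_radius_pow 1

lemma div_const (hf : Reg f) (c : ℝ) : Reg fun t R φ Z => f t R φ Z / c :=
  ⟨hf.smooth.div_const c, fun t R φ Z => by rw [hf.per]⟩

lemma fderiv_smooth (hf : Reg f) (e : ℝ × ℝ × ℝ × ℝ) :
    ContDiffOn ℝ (⊤ : ℕ∞) (fun q => fderiv ℝ (unc f) q e) posR :=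
  (hf.smooth.fderiv_of_isOpen isOpen_posR (by simp)).clm_apply contDiffOn_const

lemma dT (hf : Reg f) : Reg (dT f) :=
  ⟨(hf.fderiv_smooth (1, 0, 0, 0)).congr fun _ hq => (hasDerivAt_T hf hq).deriv,
    fun t R φ Z => by simp only [_root_.dT, hf.per]⟩

lemma dR (hf : Reg f) : Reg (dR f) :=
  ⟨(hf.fderiv_smooth (0, 1, 0, 0)).congr fun _ hq => (hasDerivAt_R hf hq).deriv,
    fun t R φ Z => by simp only [_root_.dR, hf.per]⟩

lemma dP (hf : Reg f) : Reg (dP f) :=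
  ⟨(hf.fderiv_smooth (0, 0, 1, 0)).congr fun _ hq => (hasDerivAt_P hf hq).deriv,
    fun t R φ Z => by
      simp only [_root_.dP]
      rw [← deriv_comp_add_const]
      simp only [hf.per]⟩

lemma dZ (hf : Reg f) : Reg (dZ f) :=
  ⟨(hf.fderiv_smooth (0, 0, 0, 1)).congr fun _ hq => (hasDerivAt_Z hf hq).deriv,
    fun t R φ Z => by simp only [_root_.dZ, hf.per]⟩

lemma gdot (hf : Reg f) (hg : Reg g) : Reg (gdot f g) :=
  (hf.dR.mul hg.dR).add (hf.dZ.mul hg.dZ)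

lemma B2 (F0 : ℝ) (hf : Reg f) : Reg (B2 F0 f) :=
  (((const (F0 ^ 2)).add (hf.dR.pow 2)).add (hf.dZ.pow 2)).div_radius_pow 2

lemma Bpol2 (hf : Reg f) : Reg (Bpol2 f) :=
  ((hf.dR.pow 2).add (hf.dZ.pow 2)).div_radius_pow 2

lemma rh (hf : Reg f) : Reg (rh f) := (radius.pow 2).mul hf

lemma gradu2 (hf : Reg f) : Reg (gradu2 f) := (hf.dR.pow 2).add (hf.dZ.pow 2)

lemma inv_radius : Reg fun _ R _ _ => 1 / R := (const 1).div_radius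

lemma GS (hf : Reg f) : Reg (GS f) :=
  (radius.mul (inv_radius.mul hf.dR).dR).add hf.dZ.dZ

lemma LapPol (hf : Reg f) : Reg (LapPol f) :=
  (inv_radius.mul (radius.mul hf.dR).dR).add hf.dZ.dZ

end Reg

lemma iterated_partial_comm {f : F4} (hf : Reg f) {q : ℝ × ℝ × ℝ × ℝ} (hq : q ∈ posR)
    (e d : ℝ × ℝ × ℝ × ℝ) :
    fderiv ℝ (fun p => fderiv ℝ (unc f) p e) q d
      = fderiv ℝ (fun p => fderiv ℝ (unc f) p d) q e := by
  have hf : ContDiffAt ℝ (2 : ℕ∞) (unc f) q :=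
    (hf.smooth.contDiffAt (isOpen_posR.mem_nhds hq)).of_le (WithTop.coe_le_coe.2 le_top)
  have hd : DifferentiableAt ℝ (fderiv ℝ (unc f)) q :=
    (hf.fderiv_right (m := 1) (by norm_num)).differentiableAt (by simp)
  rw [fderiv_clm_apply hd (by fun_prop), fderiv_clm_apply hd (by fun_prop)]
  simpa using (hf.isSymmSndFDerivAt
    (by rw [minSmoothness_of_isRCLikeNormedField]; norm_num)).eq d e

section Commutation

variable {f : F4} {t R φ Z : ℝ}

lemma unc_dT (hf : Reg f) (q : ℝ × ℝ × ℝ × ℝ) (hq : q ∈ posR) :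
    unc (dT f) q = fderiv ℝ (unc f) q (1, 0, 0, 0) := (hasDerivAt_T hf hq).deriv

lemma unc_dR (hf : Reg f) (q : ℝ × ℝ × ℝ × ℝ) (hq : q ∈ posR) :
    unc (dR f) q = fderiv ℝ (unc f) q (0, 1, 0, 0) := (hasDerivAt_R hf hq).deriv

lemma unc_dP (hf : Reg f) (q : ℝ × ℝ × ℝ × ℝ) (hq : q ∈ posR) :
    unc (dP f) q = fderiv ℝ (unc f) q (0, 0, 1, 0) := (hasDerivAt_P hf hq).deriv

lemma unc_dZ (hf : Reg f) (q : ℝ × ℝ × ℝ × ℝ) (hq : q ∈ posR) :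
    unc (dZ f) q = fderiv ℝ (unc f) q (0, 0, 0, 1) := (hasDerivAt_Z hf hq).deriv

lemma fderiv_congr_posR {F G : ℝ × ℝ × ℝ × ℝ → ℝ} (h : ∀ q ∈ posR, F q = G q)
    {q : ℝ × ℝ × ℝ × ℝ} (hq : q ∈ posR) : fderiv ℝ F q = fderiv ℝ G q :=
  Filter.EventuallyEq.fderiv_eq (Filter.eventuallyEq_of_mem (isOpen_posR.mem_nhds hq) h)

lemma dR_dT (hr : Reg f) (hR : 0 < R) :
    dR (dT f) t R φ Z = dT (dR f) t R φ Z := by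
  have hq : (t, R, φ, Z) ∈ posR := hR
  have h₁ := unc_dR hr.dT _ hq
  have h₂ := unc_dT hr.dR _ hq
  rw [fderiv_congr_posR (unc_dT hr) hq] at h₁
  rw [fderiv_congr_posR (unc_dR hr) hq] at h₂
  exact h₁.trans ((iterated_partial_comm hr hq _ _).trans h₂.symm)

lemma dZ_dT (hr : Reg f) (hR : 0 < R) :
    dZ (dT f) t R φ Z = dT (dZ f) t R φ Z := by
  have hq : (t, R, φ, Z) ∈ posR := hR
  have h₁ := unc_dZ hr.dT _ hq
  have h₂ := unc_dT hr.dZ _ hq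
  rw [fderiv_congr_posR (unc_dT hr) hq] at h₁
  rw [fderiv_congr_posR (unc_dZ hr) hq] at h₂
  exact h₁.trans ((iterated_partial_comm hr hq _ _).trans h₂.symm)

lemma dR_dP (hr : Reg f) (hR : 0 < R) :
    dR (dP f) t R φ Z = dP (dR f) t R φ Z := by
  have hq : (t, R, φ, Z) ∈ posR := hR
  have h₁ := unc_dR hr.dP _ hq
  have h₂ := unc_dP hr.dR _ hq
  rw [fderiv_congr_posR (unc_dP hr) hq] at h₁
  rw [fderiv_congr_posR (unc_dR hr) hq] at h₂
  exact h₁.trans ((iterated_partial_comm hr hq _ _).trans h₂.symm)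

lemma dZ_dP (hr : Reg f) (hR : 0 < R) :
    dZ (dP f) t R φ Z = dP (dZ f) t R φ Z := by
  have hq : (t, R, φ, Z) ∈ posR := hR
  have h₁ := unc_dZ hr.dP _ hq
  have h₂ := unc_dP hr.dZ _ hq
  rw [fderiv_congr_posR (unc_dP hr) hq] at h₁
  rw [fderiv_congr_posR (unc_dZ hr) hq] at h₂
  exact h₁.trans ((iterated_partial_comm hr hq _ _).trans h₂.symm)

lemma dR_dZ (hr : Reg f) (hR : 0 < R) : dR (dZ f) t R φ Z = dZ (dR f) t R φ Z := by
  have hq : (t, R, φ, Z) ∈ posR := hR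
  have h₁ := unc_dR hr.dZ _ hq
  have h₂ := unc_dZ hr.dR _ hq
  rw [fderiv_congr_posR (unc_dZ hr) hq] at h₁
  rw [fderiv_congr_posR (unc_dR hr) hq] at h₂
  exact h₁.trans ((iterated_partial_comm hr hq _ _).trans h₂.symm)

end Commutation

namespace Good

variable {K : Set (ℝ × ℝ)} {f g : F4}

lemma contDiff (hK : IsClosed K) (hpos : ∀ q ∈ K, 0 < q.1) (hf : Good K f) :
    ContDiff ℝ (⊤ : ℕ∞) (unc f) := by
  refine contDiff_iff_contDiffAt.2 fun q => ?_
  by_cases hq : (q.2.1, q.2.2.2) ∈ K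
  · exact hf.reg.smooth.contDiffAt (isOpen_posR.mem_nhds (hpos _ hq))
  · have hopen : IsOpen {q : ℝ × ℝ × ℝ × ℝ | (q.2.1, q.2.2.2) ∉ K} :=
      hK.isOpen_compl.preimage (by fun_prop : Continuous fun q : ℝ × ℝ × ℝ × ℝ => (q.2.1, q.2.2.2))
    exact (contDiffAt_const (c := 0)).congr_of_eventuallyEq
      (Filter.eventuallyEq_of_mem (hopen.mem_nhds hq) fun p hp => hf.supp _ _ _ _ hp)

lemma mul_right (hf : Good K f) (hg : Reg g) : Good K fun t R φ Z => f t R φ Z * g t R φ Z :=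
  ⟨hf.reg.mul hg, fun t R φ Z h => by rw [hf.supp _ _ _ _ h, zero_mul]⟩

lemma mul_left (hf : Reg f) (hg : Good K g) : Good K fun t R φ Z => f t R φ Z * g t R φ Z :=
  ⟨hf.mul hg.reg, fun t R φ Z h => by rw [hg.supp _ _ _ _ h, mul_zero]⟩

lemma dT (hf : Good K f) : Good K (dT f) :=
  ⟨hf.reg.dT, fun t R φ Z h => by simp [_root_.dT, hf.supp _ _ _ _ h]⟩

lemma dP (hf : Good K f) : Good K (dP f) :=
  ⟨hf.reg.dP, fun t R φ Z h => by simp [_root_.dP, hf.supp _ _ _ _ h]⟩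

lemma dR (hK : IsClosed K) (hf : Good K f) : Good K (dR f) :=
  ⟨hf.reg.dR, fun t R φ Z h => by
    have h₀ : (fun r => f t r φ Z) =ᶠ[nhds R] fun _ => 0 :=
      Filter.eventuallyEq_of_mem ((hK.isOpen_compl.preimage
        (by fun_prop : Continuous fun r : ℝ => (r, Z))).mem_nhds h) fun p hp => hf.supp _ _ _ _ hp
    exact h₀.deriv_eq.trans (deriv_const _ _)⟩

lemma dZ (hK : IsClosed K) (hf : Good K f) : Good K (dZ f) :=
  ⟨hf.reg.dZ, fun t R φ Z h => by
    have h₀ : (fun z => f t R φ z) =ᶠ[nhds Z] fun _ => 0 :=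
      Filter.eventuallyEq_of_mem ((hK.isOpen_compl.preimage
        (by fun_prop : Continuous fun z : ℝ => (R, z))).mem_nhds h) fun p hp => hf.supp _ _ _ _ hp
    exact h₀.deriv_eq.trans (deriv_const _ _)⟩

end Good

/-- The field is integrable over one period in `φ` and `K`, with zero integral at every time. -/
def Null (K : Set (ℝ × ℝ)) (f : F4) : Prop :=
  ∀ t, IntegrableOn (fun x : ℝ × ℝ × ℝ => f t x.2.1 x.1 x.2.2) (Set.Icc 0 (2 * π) ×ˢ K) ∧
    ∫ x in Set.Icc 0 (2 * π) ×ˢ K, f t x.2.1 x.1 x.2.2 = 0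

namespace Null

variable {K : Set (ℝ × ℝ)} {f g : F4}

lemma add (hf : Null K f) (hg : Null K g) : Null K fun t R φ Z => f t R φ Z + g t R φ Z :=
  fun t => ⟨(hf t).1.add (hg t).1, by
    rw [integral_add (hf t).1 (hg t).1, (hf t).2, (hg t).2, add_zero]⟩

lemma smul (c : ℝ) (hf : Null K f) : Null K fun t R φ Z => c * f t R φ Z :=
  fun t => ⟨(hf t).1.const_mul c, by rw [integral_const_mul, (hf t).2, mul_zero]⟩

lemma congr (hK : IsCompact K) (hf : Null K f)
    (h : ∀ t R φ Z, (R, Z) ∈ K → g t R φ Z = f t R φ Z) : Null K g := fun t => by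
  have hS : MeasurableSet (Set.Icc 0 (2 * π) ×ˢ K) := measurableSet_Icc.prod hK.measurableSet
  have hEq : Set.EqOn (fun x : ℝ × ℝ × ℝ => g t x.2.1 x.1 x.2.2)
      (fun x => f t x.2.1 x.1 x.2.2) (Set.Icc 0 (2 * π) ×ˢ K) := fun x hx => h _ _ _ _ hx.2
  exact ⟨(hf t).1.congr_fun hEq.symm hS, (setIntegral_congr_fun hS hEq).trans (hf t).2⟩

end Null

section Flux

variable {K : Set (ℝ × ℝ)} {f : F4}

lemma Good.integrableOn (hK : IsCompact K) (hpos : ∀ q ∈ K, 0 < q.1) (hf : Good K f) (t : ℝ) :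
    IntegrableOn (fun x : ℝ × ℝ × ℝ => f t x.2.1 x.1 x.2.2) (Set.Icc 0 (2 * π) ×ˢ K) := by
  have hc := (hf.contDiff hK.isClosed hpos).continuous.comp
    (by fun_prop : Continuous fun x : ℝ × ℝ × ℝ => (t, x.2.1, x.1, x.2.2))
  exact hc.continuousOn.integrableOn_compact (isCompact_Icc.prod hK)

lemma Good.setIntegral_eq (hK : IsCompact K) (hpos : ∀ q ∈ K, 0 < q.1) (hf : Good K f) (t : ℝ) :
    ∫ x in Set.Icc 0 (2 * π) ×ˢ K, f t x.2.1 x.1 x.2.2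
      = ∫ φ in Set.Icc 0 (2 * π), ∫ q : ℝ × ℝ, f t q.1 φ q.2 := by
  refine (setIntegral_prod _ (hf.integrableOn hK hpos t)).trans ?_
  exact integral_congr_ae (Filter.Eventually.of_forall fun φ =>
    setIntegral_eq_integral_of_forall_compl_eq_zero fun q hq => hf.supp _ _ _ _ hq)

lemma Good.integrable_slice (hK : IsCompact K) (hpos : ∀ q ∈ K, 0 < q.1) (hf : Good K f)
    (t φ : ℝ) : Integrable fun q : ℝ × ℝ => f t q.1 φ q.2 :=
  ((hf.contDiff hK.isClosed hpos).continuous.comp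
    (by fun_prop : Continuous fun q : ℝ × ℝ => (t, q.1, φ, q.2))).integrable_of_hasCompactSupport
    (HasCompactSupport.intro hK fun q hq => hf.supp _ _ _ _ hq)

lemma Good.integrable_R (hK : IsCompact K) (hpos : ∀ q ∈ K, 0 < q.1) (hf : Good K f)
    (t φ Z : ℝ) : Integrable fun r : ℝ => f t r φ Z :=
  ((hf.contDiff hK.isClosed hpos).continuous.comp
    (by fun_prop : Continuous fun r : ℝ => (t, r, φ, Z))).integrable_of_hasCompactSupport
    (HasCompactSupport.intro (hK.image continuous_fst) fun r hr =>
      hf.supp _ _ _ _ fun h => hr ⟨_, h, rfl⟩)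

lemma Good.integrable_Z (hK : IsCompact K) (hpos : ∀ q ∈ K, 0 < q.1) (hf : Good K f)
    (t R φ : ℝ) : Integrable fun z : ℝ => f t R φ z :=
  ((hf.contDiff hK.isClosed hpos).continuous.comp
    (by fun_prop : Continuous fun z : ℝ => (t, R, φ, z))).integrable_of_hasCompactSupport
    (HasCompactSupport.intro (hK.image continuous_snd) fun z hz =>
      hf.supp _ _ _ _ fun h => hz ⟨_, h, rfl⟩)

lemma null_dR (hK : IsCompact K) (hpos : ∀ q ∈ K, 0 < q.1) (hf : Good K f) : Null K (dR f) := by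
  have hd := hf.dR hK.isClosed
  have hsm := (hf.contDiff hK.isClosed hpos).differentiable (by simp)
  refine fun t => ⟨hd.integrableOn hK hpos t, ?_⟩
  rw [hd.setIntegral_eq hK hpos]
  refine integral_eq_zero_of_ae (Filter.Eventually.of_forall fun φ => ?_)
  refine (integral_prod_symm _ (hd.integrable_slice hK hpos t φ)).trans ?_
  refine integral_eq_zero_of_ae (Filter.Eventually.of_forall fun Z => ?_)
  exact integral_eq_zero_of_hasDerivAt_of_integrable
    (fun r => ((hsm.comp (by fun_prop : Differentiable ℝ fun r : ℝ => (t, r, φ, Z))) r).hasDerivAt)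
    (hd.integrable_R hK hpos t φ Z) (hf.integrable_R hK hpos t φ Z)

lemma null_dZ (hK : IsCompact K) (hpos : ∀ q ∈ K, 0 < q.1) (hf : Good K f) : Null K (dZ f) := by
  have hd := hf.dZ hK.isClosed
  have hsm := (hf.contDiff hK.isClosed hpos).differentiable (by simp)
  refine fun t => ⟨hd.integrableOn hK hpos t, ?_⟩
  rw [hd.setIntegral_eq hK hpos]
  refine integral_eq_zero_of_ae (Filter.Eventually.of_forall fun φ => ?_)
  refine (integral_prod _ (hd.integrable_slice hK hpos t φ)).trans ?_
  refine integral_eq_zero_of_ae (Filter.Eventually.of_forall fun R => ?_)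
  exact integral_eq_zero_of_hasDerivAt_of_integrable
    (fun z => ((hsm.comp (by fun_prop : Differentiable ℝ fun z : ℝ => (t, R, φ, z))) z).hasDerivAt)
    (hd.integrable_Z hK hpos t R φ) (hf.integrable_Z hK hpos t R φ)

lemma null_dP (hK : IsCompact K) (hpos : ∀ q ∈ K, 0 < q.1) (hf : Good K f) : Null K (dP f) := by
  have hd := hf.dP
  have hsm := (hf.contDiff hK.isClosed hpos).differentiable (by simp)
  refine fun t => ⟨hd.integrableOn hK hpos t, ?_⟩
  have hint := hd.integrableOn hK hpos t
  rw [IntegrableOn, Measure.volume_eq_prod, ← Measure.prod_restrict] at hint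
  rw [Measure.volume_eq_prod, ← Measure.prod_restrict]
  refine (integral_prod_symm _ hint).trans ?_
  refine integral_eq_zero_of_ae (Filter.Eventually.of_forall fun q => ?_)
  have hc : Continuous fun φ => dP f t q.1 φ q.2 :=
    (hd.contDiff hK.isClosed hpos).continuous.comp
      (by fun_prop : Continuous fun φ : ℝ => (t, q.1, φ, q.2))
  have key := intervalIntegral.integral_eq_sub_of_hasDerivAt (a := 0) (b := 2 * π)
    (f := fun φ => f t q.1 φ q.2) (f' := fun φ => dP f t q.1 φ q.2)
    (fun φ _ => ((hsm.comp
      (by fun_prop : Differentiable ℝ fun φ : ℝ => (t, q.1, φ, q.2))) φ).hasDerivAt)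
    (hc.intervalIntegrable _ _)
  have hper := hf.reg.per t q.1 0 q.2
  rw [zero_add] at hper
  rw [hper, sub_self, intervalIntegral.integral_of_le (by positivity),
    ← integral_Icc_eq_integral_Ioc] at key
  exact key

/-- If the time derivative integrates to zero, the integral is constant in time. -/
lemma integral_const_of_null (hK : IsCompact K) (hpos : ∀ q ∈ K, 0 < q.1) (hf : Good K f)
    (h : Null K (dT f)) (t₁ t₂ : ℝ) :
    (∫ φ in (0:ℝ)..(2 * π), ∫ q in K, f t₁ q.1 φ q.2)
      = ∫ φ in (0:ℝ)..(2 * π), ∫ q in K, f t₂ q.1 φ q.2 := by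
  have hconv : ∀ t, (∫ φ in (0:ℝ)..(2 * π), ∫ q in K, f t q.1 φ q.2)
      = ∫ x in Set.Icc 0 (2 * π) ×ˢ K, f t x.2.1 x.1 x.2.2 := fun t => by
    rw [intervalIntegral.integral_of_le (by positivity), ← integral_Icc_eq_integral_Ioc]
    exact (setIntegral_prod _ (hf.integrableOn hK hpos t)).symm
  rw [hconv, hconv, eq_comm, ← sub_eq_zero,
    ← integral_sub (hf.integrableOn hK hpos t₂) (hf.integrableOn hK hpos t₁)]
  have hd := hf.dT
  have hsm := (hf.contDiff hK.isClosed hpos).differentiable (by simp)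
  have hdc := (hd.contDiff hK.isClosed hpos).continuous
  have hftc : ∀ x : ℝ × ℝ × ℝ, f t₂ x.2.1 x.1 x.2.2 - f t₁ x.2.1 x.1 x.2.2
      = ∫ t in t₁..t₂, dT f t x.2.1 x.1 x.2.2 := fun x =>
    (intervalIntegral.integral_eq_sub_of_hasDerivAt
      (f := fun t => f t x.2.1 x.1 x.2.2) (f' := fun t => dT f t x.2.1 x.1 x.2.2)
      (fun t _ => ((hsm.comp
        (by fun_prop : Differentiable ℝ fun t : ℝ => (t, x.2.1, x.1, x.2.2))) t).hasDerivAt)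
      ((hdc.comp (by fun_prop : Continuous fun t : ℝ =>
        (t, x.2.1, x.1, x.2.2))).intervalIntegrable _ _)).symm
  simp_rw [hftc]
  rw [← intervalIntegral_integral_swap]
  · simp_rw [fun t => (h t).2]
    simp
  · rw [Measure.prod_restrict]
    have hc : Continuous fun y : ℝ × ℝ × ℝ × ℝ => dT f y.1 y.2.2.1 y.2.1 y.2.2.2 :=
      hdc.comp (by fun_prop : Continuous fun y : ℝ × ℝ × ℝ × ℝ =>
        (y.1, y.2.2.1, y.2.1, y.2.2.2))
    exact (hc.continuousOn.integrableOn_compact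
      (isCompact_uIcc.prod (isCompact_Icc.prod hK))).mono_set
        (Set.prod_mono Set.uIoc_subset_uIcc subset_rfl)

end Flux

section IntegrationByParts

variable {K : Set (ℝ × ℝ)} {f g h : F4}

lemma null_mul_dR (hK : IsCompact K) (hpos : ∀ q ∈ K, 0 < q.1) (hf : Good K f) (hg : Reg g) :
    Null K fun t R φ Z => f t R φ Z * dR g t R φ Z + g t R φ Z * dR f t R φ Z :=
  (null_dR hK hpos (hf.mul_right hg)).congr hK fun t R φ Z hq => by
    rw [dR_mul hf.reg hg (hpos _ hq)]; ring

lemma null_mul_dZ (hK : IsCompact K) (hpos : ∀ q ∈ K, 0 < q.1) (hf : Good K f) (hg : Reg g) :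
    Null K fun t R φ Z => f t R φ Z * dZ g t R φ Z + g t R φ Z * dZ f t R φ Z :=
  (null_dZ hK hpos (hf.mul_right hg)).congr hK fun t R φ Z hq => by
    rw [dZ_mul hf.reg hg (hpos _ hq)]; ring

lemma null_mul_dP (hK : IsCompact K) (hpos : ∀ q ∈ K, 0 < q.1) (hf : Good K f) (hg : Reg g) :
    Null K fun t R φ Z => 1 / R * (f t R φ Z * dP g t R φ Z + g t R φ Z * dP f t R φ Z) :=
  (null_dP hK hpos ((hf.mul_right hg).mul_right Reg.inv_radius)).congr hK fun t R φ Z hq => by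
    rw [dP_mul (hf.reg.mul hg) Reg.inv_radius (hpos _ hq), dP_mul hf.reg hg (hpos _ hq)]
    simp only [dP, deriv_const]
    ring

lemma null_mul_pb (hK : IsCompact K) (hpos : ∀ q ∈ K, 0 < q.1) (hf : Good K f) (hg : Reg g)
    (hh : Reg h) : Null K fun t R φ Z => f t R φ Z * pb g h t R φ Z + g t R φ Z * pb f h t R φ Z :=
  ((null_dR hK hpos ((hf.mul_right hg).mul_right hh.dZ)).add
    ((null_dZ hK hpos ((hf.mul_right hg).mul_right hh.dR)).smul (-1))).congr hK
    fun t R φ Z hq => by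
      have hR : 0 < R := hpos _ hq
      rw [dR_mul (hf.reg.mul hg) hh.dZ hR, dR_mul hf.reg hg hR, dZ_mul (hf.reg.mul hg) hh.dR hR,
        dZ_mul hf.reg hg hR, dR_dZ hh hR]
      simp only [pb]
      ring

lemma null_mul_divC (hK : IsCompact K) (hpos : ∀ q ∈ K, 0 < q.1) (hf : Good K f) (hg : Reg g)
    (hh : Reg h) : Null K fun t R φ Z => R * (f t R φ Z * divC g zeroF h t R φ Z
      + g t R φ Z * dR f t R φ Z + h t R φ Z * dZ f t R φ Z) :=
  ((null_dR hK hpos (hf.mul_right (Reg.radius.mul hg))).add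
    (null_dZ hK hpos (hf.mul_right (Reg.radius.mul hh)))).congr hK
    fun t R φ Z hq => by
      have hR : 0 < R := hpos _ hq
      have hP : dP zeroF t R φ Z = 0 := by simp [dP, zeroF]
      have hZ : dZ (fun _ r _ _ => r) t R φ Z = 0 := by simp [dZ]
      rw [dR_mul hf.reg (Reg.radius.mul hg) hR, dZ_mul hf.reg (Reg.radius.mul hh) hR,
        dZ_mul Reg.radius hh hR]
      simp only [divC, hP, hZ]
      field_simp
      ring

end IntegrationByParts

section Expansions

variable {f g : F4} {t R φ Z : ℝ}

lemma dR_sq_mul (hf : Reg f) (hg : Reg g) (hR : 0 < R) :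
    dR (fun s r a z => f s r a z ^ 2 * g s r a z) t R φ Z
      = 2 * f t R φ Z * dR f t R φ Z * g t R φ Z + f t R φ Z ^ 2 * dR g t R φ Z :=
  (((dR_spec hf hR).pow 2).mul (dR_spec hg hR)).deriv.trans (by simp only [Pi.pow_apply]; ring)

lemma dZ_sq_mul (hf : Reg f) (hg : Reg g) (hR : 0 < R) :
    dZ (fun s r a z => f s r a z ^ 2 * g s r a z) t R φ Z
      = 2 * f t R φ Z * dZ f t R φ Z * g t R φ Z + f t R φ Z ^ 2 * dZ g t R φ Z :=
  (((dZ_spec hf hR).pow 2).mul (dZ_spec hg hR)).deriv.trans (by simp only [Pi.pow_apply]; ring)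

lemma dR_div_const (c : ℝ) :
    dR (fun s r a z => f s r a z / c) t R φ Z = dR f t R φ Z / c := deriv_div_const _

lemma dZ_div_const (c : ℝ) :
    dZ (fun s r a z => f s r a z / c) t R φ Z = dZ f t R φ Z / c := deriv_div_const _

lemma dR_radius_sq : dR (fun _ r _ _ => r ^ 2) t R φ Z = 2 * R := by simp [dR]

lemma dZ_radius_sq : dZ (fun _ r _ _ => r ^ 2) t R φ Z = 0 := by simp [dZ]

lemma dR_rh (hf : Reg f) (hR : 0 < R) :
    dR (rh f) t R φ Z = 2 * R * f t R φ Z + R ^ 2 * dR f t R φ Z :=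
  (dR_mul (Reg.radius.pow 2) hf hR).trans (by rw [dR_radius_sq])

lemma dZ_rh (hf : Reg f) (hR : 0 < R) : dZ (rh f) t R φ Z = R ^ 2 * dZ f t R φ Z :=
  (dZ_mul (Reg.radius.pow 2) hf hR).trans (by rw [dZ_radius_sq]; ring)

lemma dP_gdot (hf : Reg f) (hg : Reg g) (hR : 0 < R) :
    dP (gdot f g) t R φ Z
      = dP (dR f) t R φ Z * dR g t R φ Z + dR f t R φ Z * dP (dR g) t R φ Z
        + (dP (dZ f) t R φ Z * dZ g t R φ Z + dZ f t R φ Z * dP (dZ g) t R φ Z) :=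
  (((dP_spec hf.dR hR).mul (dP_spec hg.dR hR)).add
    ((dP_spec hf.dZ hR).mul (dP_spec hg.dZ hR))).deriv

lemma dP_sq_radius_gradu2 (hf : Reg f) (hR : 0 < R) :
    dP (fun s r a z => r ^ 2 * gradu2 f s r a z) t R φ Z
      = 2 * R ^ 2 * (dR f t R φ Z * dP (dR f) t R φ Z + dZ f t R φ Z * dP (dZ f) t R φ Z) :=
  ((((dP_spec hf.dR hR).pow 2).add ((dP_spec hf.dZ hR).pow 2)).const_mul (R ^ 2)).deriv.trans
    (by ring)

end Expansions

lemma null_GS {K : Set (ℝ × ℝ)} {f g : F4} (hK : IsCompact K) (hpos : ∀ q ∈ K, 0 < q.1)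
    (hf : Good K f) (hg : Reg g) :
    Null K fun t R φ Z => f t R φ Z * GS g t R φ Z / R
      + (dR g t R φ Z * dR f t R φ Z + dZ g t R φ Z * dZ f t R φ Z) / R := by
  refine ((null_mul_dR hK hpos hf (Reg.inv_radius.mul hg.dR)).add
    (null_mul_dZ hK hpos hf (Reg.inv_radius.mul hg.dZ))).congr hK fun t R φ Z hq => ?_
  have hR : 0 < R := hpos _ hq
  have hZ : dZ (fun _ r _ _ => 1 / r) t R φ Z = 0 := by simp [dZ]
  rw [dZ_mul Reg.inv_radius hg.dZ hR, hZ]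
  simp only [GS]
  field_simp
  ring

lemma Reg.Edens {ψ u ρ p v : F4} (γ F0 : ℝ) (hψ : Reg ψ) (hu : Reg u) (hρ : Reg ρ) (hp : Reg p)
    (hv : Reg v) : Reg (Edens γ F0 ψ u ρ p v) := by
  have h := (((hψ.dR.pow 2).add (hψ.dZ.pow 2)).div_const 2).div_radius_pow 2 |>.add
    ((hρ.div_const 2).mul ((((Reg.radius.pow 2).mul ((hu.dR.pow 2).add (hu.dZ.pow 2))).add
      ((hv.pow 2).mul (hψ.B2 F0))).sub (((Reg.const 2).mul hv).mul (hψ.gdot hu)))) |>.add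
    (hp.div_const (γ - 1))
  simp only [div_div] at h
  exact h

lemma dT_Edens_mul_radius {ψ u ρ p v : F4} (γ F0 : ℝ) (hψ : Reg ψ) (hu : Reg u) (hρ : Reg ρ)
    (hp : Reg p) (hv : Reg v) {t R φ Z : ℝ} (hR : 0 < R) :
    dT (fun s r a z => Edens γ F0 ψ u ρ p v s r a z * r) t R φ Z
      = ((dR ψ t R φ Z * dT (dR ψ) t R φ Z + dZ ψ t R φ Z * dT (dZ ψ) t R φ Z) / R ^ 2
        + dT ρ t R φ Z / 2 * (R ^ 2 * ((dR u t R φ Z) ^ 2 + (dZ u t R φ Z) ^ 2)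
          + v t R φ Z ^ 2 * B2 F0 ψ t R φ Z - 2 * v t R φ Z * gdot ψ u t R φ Z)
        + ρ t R φ Z * (R ^ 2 * (dR u t R φ Z * dT (dR u) t R φ Z
              + dZ u t R φ Z * dT (dZ u) t R φ Z)
          + v t R φ Z * dT v t R φ Z * B2 F0 ψ t R φ Z
          + v t R φ Z ^ 2 * (dR ψ t R φ Z * dT (dR ψ) t R φ Z
              + dZ ψ t R φ Z * dT (dZ ψ) t R φ Z) / R ^ 2
          - dT v t R φ Z * gdot ψ u t R φ Z
          - v t R φ Z * (dT (dR ψ) t R φ Z * dR u t R φ Z + dR ψ t R φ Z * dT (dR u) t R φ Z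
            + dT (dZ ψ) t R φ Z * dZ u t R φ Z + dZ ψ t R φ Z * dT (dZ u) t R φ Z))
        + dT p t R φ Z / (γ - 1)) * R := by
  have hψR := dT_spec (t := t) (φ := φ) (Z := Z) hψ.dR hR
  have hψZ := dT_spec (t := t) (φ := φ) (Z := Z) hψ.dZ hR
  have huR := dT_spec (t := t) (φ := φ) (Z := Z) hu.dR hR
  have huZ := dT_spec (t := t) (φ := φ) (Z := Z) hu.dZ hR
  have hρt := dT_spec (t := t) (φ := φ) (Z := Z) hρ hR
  have hpt := dT_spec (t := t) (φ := φ) (Z := Z) hp hR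
  have hvt := dT_spec (t := t) (φ := φ) (Z := Z) hv hR
  have hB := (((hψR.pow 2).const_add (F0 ^ 2)).add (hψZ.pow 2)).div_const (R ^ 2)
  have hG := (hψR.mul huR).add (hψZ.mul huZ)
  have h := ((((((hψR.pow 2).add (hψZ.pow 2)).div_const (2 * R ^ 2)).add
    ((hρt.div_const 2).mul (((((huR.pow 2).add (huZ.pow 2)).const_mul (R ^ 2)).add
      ((hvt.pow 2).mul hB)).sub ((hvt.const_mul 2).mul hG)))).add
    (hpt.div_const (γ - 1))).mul_const R)
  refine h.deriv.trans ?_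
  simp only [B2, gdot, Pi.add_apply, Pi.mul_apply, Pi.sub_apply, Pi.pow_apply]
  field_simp
  ring

/-- total energy conservation for the ideal reduced MHD model with
parallel velocity. -/
theorem reduced_mhd_energy_conservation (γ F0 : ℝ) (hγ : 1 < γ)
    (ψ u ρ p vpar : F4)
    (hψ : Smooth4 ψ) (hu : Smooth4 u) (hρ : Smooth4 ρ) (hp : Smooth4 p) (hvpar : Smooth4 vpar)
    (hper : ∀ t R φ Z : ℝ,
      ψ t R (φ + 2 * π) Z = ψ t R φ Z ∧ u t R (φ + 2 * π) Z = u t R φ Z ∧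
      ρ t R (φ + 2 * π) Z = ρ t R φ Z ∧ p t R (φ + 2 * π) Z = p t R φ Z ∧
      vpar t R (φ + 2 * π) Z = vpar t R φ Z)
    (K : Set (ℝ × ℝ)) (hK : IsCompact K) (hKpos : ∀ q ∈ K, 0 < q.1)
    (hsupp : ∀ t R φ Z : ℝ, (R, Z) ∉ K →
      ψ t R φ Z = 0 ∧ u t R φ Z = 0 ∧ ρ t R φ Z = 0 ∧ p t R φ Z = 0 ∧ vpar t R φ Z = 0)
    -- (i) flux equation
    (hi : ∀ t R φ Z : ℝ, 0 < R →
      dT ψ t R φ Z = R * pb ψ u t R φ Z - F0 * dP u t R φ Z)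
    -- (ii) poloidal momentum (vorticity) equation
    (hii : ∀ t R φ Z : ℝ, 0 < R →
      divC (fun s r a z => rh ρ s r a z * dR (dT u) s r a z) zeroF
          (fun s r a z => rh ρ s r a z * dZ (dT u) s r a z) t R φ Z
        - divC
            (fun s r a z => ρ s r a z
              * dT (fun s' r' a' z' => vpar s' r' a' z' * dR ψ s' r' a' z') s r a z)
            zeroF
            (fun s r a z => ρ s r a z
              * dT (fun s' r' a' z' => vpar s' r' a' z' * dZ ψ s' r' a' z') s r a z)
            t R φ Z
      = (1 / (2 * R)) * pb (fun s r a z => r ^ 2 * gradu2 u s r a z) (rh ρ) t R φ Z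
        + (1 / R) * pb (fun s r a z => rh ρ s r a z * r ^ 2 * LapPol u s r a z) u t R φ Z
        - (1 / R) * pb (fun _ r _ _ => r ^ 2) p t R φ Z
        + (1 / R) * pb ψ (GS ψ) t R φ Z
        - (F0 / R ^ 2) * dP (GS ψ) t R φ Z
        + (1 / R) * pb (fun s r a z => ρ s r a z * vpar s r a z ^ 2 * GS ψ s r a z) ψ t R φ Z
        + (1 / R) * pb (fun s r a z => ρ s r a z * vpar s r a z * gdot vpar ψ s r a z) ψ t R φ Z
        - divC (fun s r a z => rh ρ s r a z * (F0 / r ^ 2) * vpar s r a z * dR (dP u) s r a z)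
            zeroF
            (fun s r a z => rh ρ s r a z * (F0 / r ^ 2) * vpar s r a z * dZ (dP u) s r a z)
            t R φ Z
        + (1 / R) * pb (rh ρ) (fun s r a z => vpar s r a z * gdot ψ u s r a z) t R φ Z
        - (1 / (2 * R)) * pb (rh ρ) (fun s r a z => vpar s r a z ^ 2 * Bpol2 ψ s r a z) t R φ Z
        - (1 / R) * pb (fun s r a z => rh ρ s r a z * vpar s r a z * LapPol u s r a z) ψ t R φ Z
        + (1 / R) * pb u (fun s r a z => rh ρ s r a z * vpar s r a z * GS ψ s r a z) t R φ Z
        + (1 / R) * pb u (fun s r a z => rh ρ s r a z * gdot ψ vpar s r a z) t R φ Z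
        + (1 / R) * dZ (fun s r a z => rh ρ s r a z * (F0 / r ^ 3) * vpar s r a z
            * dP (fun s' r' a' z' => vpar s' r' a' z' * dZ ψ s' r' a' z') s r a z) t R φ Z
        + (1 / R) * dR (fun s r a z => rh ρ s r a z * (F0 / r ^ 3) * vpar s r a z
            * dP (fun s' r' a' z' => vpar s' r' a' z' * dR ψ s' r' a' z') s r a z) t R φ Z
        - (1 / R) * dZ (fun s r a z => rh ρ s r a z * (F0 ^ 2 / r ^ 3) * vpar s r a z ^ 2)
            t R φ Z)
    -- (iii) density equation
    (hiii : ∀ t R φ Z : ℝ, 0 < R →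
      dT ρ t R φ Z
        = R * pb ρ u t R φ Z + 2 * ρ t R φ Z * dZ u t R φ Z
          - (vpar t R φ Z * F0 / R ^ 2) * dP ρ t R φ Z
          - (vpar t R φ Z / R) * pb ρ ψ t R φ Z
          - (ρ t R φ Z / R) * pb vpar ψ t R φ Z
          - (ρ t R φ Z * F0 / R ^ 2) * dP vpar t R φ Z)
    -- (iv) pressure equation
    (hiv : ∀ t R φ Z : ℝ, 0 < R →
      dT p t R φ Z
        = R * pb p u t R φ Z + 2 * γ * p t R φ Z * dZ u t R φ Z
          - (vpar t R φ Z * F0 / R ^ 2) * dP p t R φ Z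
          - (vpar t R φ Z / R) * pb p ψ t R φ Z
          - (γ * p t R φ Z / R) * pb vpar ψ t R φ Z
          - (γ * p t R φ Z * F0 / R ^ 2) * dP vpar t R φ Z)
    -- (v) parallel velocity equation
    (hv : ∀ t R φ Z : ℝ, 0 < R →
      ρ t R φ Z * B2 F0 ψ t R φ Z * dT vpar t R φ Z
          + (ρ t R φ Z * vpar t R φ Z / R ^ 2) * gdot ψ (dT ψ) t R φ Z
          - ρ t R φ Z * gdot ψ (dT u) t R φ Z
        = -(1 / R) * pb p ψ t R φ Z - (F0 / R ^ 2) * dP p t R φ Z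
          + (ρ t R φ Z / R)
            * pb ψ (fun s r a z => vpar s r a z ^ 2 * B2 F0 ψ s r a z / 2) t R φ Z
          - (F0 / R ^ 2) * ρ t R φ Z
            * dP (fun s r a z => vpar s r a z ^ 2 * B2 F0 ψ s r a z / 2) t R φ Z
          - (1 / (2 * R)) * ρ t R φ Z
            * pb (fun s r a z => r ^ 2 * gradu2 u s r a z) ψ t R φ Z
          - (rh ρ t R φ Z / R) * LapPol u t R φ Z * pb ψ u t R φ Z
          - R * ρ t R φ Z * B2 F0 ψ t R φ Z * pb u vpar t R φ Z
          - R * ρ t R φ Z * vpar t R φ Z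
            * pb u (fun s r a z => B2 F0 ψ s r a z / 2) t R φ Z
          + R * ρ t R φ Z * vpar t R φ Z
            * pb u (fun s r a z => Bpol2 ψ s r a z / 2) t R φ Z
          - ρ t R φ Z * vpar t R φ Z * (GS ψ t R φ Z / R) * pb u ψ t R φ Z
          - (ρ t R φ Z * vpar t R φ Z / R) * pb ψ (gdot ψ u) t R φ Z
          + (ρ t R φ Z * vpar t R φ Z * F0 / R ^ 2) * gdot ψ (dP u) t R φ Z
          + ρ t R φ Z * vpar t R φ Z * (F0 ^ 2 / R ^ 2) * dZ u t R φ Z) :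
    ∀ t₁ t₂ : ℝ,
      (∫ φ in (0:ℝ)..(2 * π), ∫ q in K, Edens γ F0 ψ u ρ p vpar t₁ q.1 φ q.2 * q.1)
        = ∫ φ in (0:ℝ)..(2 * π), ∫ q in K, Edens γ F0 ψ u ρ p vpar t₂ q.1 φ q.2 * q.1 := by
  have rψ : Reg ψ := ⟨hψ.contDiffOn, fun t R φ Z => (hper t R φ Z).1⟩
  have ru : Reg u := ⟨hu.contDiffOn, fun t R φ Z => (hper t R φ Z).2.1⟩
  have rρ : Reg ρ := ⟨hρ.contDiffOn, fun t R φ Z => (hper t R φ Z).2.2.1⟩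
  have rp : Reg p := ⟨hp.contDiffOn, fun t R φ Z => (hper t R φ Z).2.2.2.1⟩
  have rv : Reg vpar := ⟨hvpar.contDiffOn, fun t R φ Z => (hper t R φ Z).2.2.2.2⟩
  have gψ : Good K ψ := ⟨rψ, fun t R φ Z h => (hsupp t R φ Z h).1⟩
  have gu : Good K u := ⟨ru, fun t R φ Z h => (hsupp t R φ Z h).2.1⟩
  have gρ : Good K ρ := ⟨rρ, fun t R φ Z h => (hsupp t R φ Z h).2.2.1⟩
  have gp : Good K p := ⟨rp, fun t R φ Z h => (hsupp t R φ Z h).2.2.2.1⟩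
  have gE : Good K (fun t R φ Z => Edens γ F0 ψ u ρ p vpar t R φ Z * R) :=
    ⟨(Reg.Edens γ F0 rψ ru rρ rp rv).mul Reg.radius, fun t R φ Z h => by
      simp [Edens, (gψ.dR hK.isClosed).supp _ _ _ _ h, (gψ.dZ hK.isClosed).supp _ _ _ _ h,
        gρ.supp _ _ _ _ h, gp.supp _ _ _ _ h]⟩
  have rr2 : Reg fun _ r _ _ => r ^ 2 := Reg.radius.pow 2
  have rρh : Reg (rh ρ) := rρ.rh
  have gh : Good K (rh ρ) := Good.mul_left rr2 gρ
  have gρv := gρ.mul_right rv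
  have rQ₁ := rr2.mul ru.gradu2
  have rQ₂ := ((rv.pow 2).mul (rψ.B2 F0)).div_const 2
  have rQ₃ := rv.mul (rψ.gdot ru)
  have rF (n : ℕ) (c : ℝ) := (Reg.const c).div_radius_pow n
  -- magnetic energy and inertia
  have nM := null_GS hK hKpos gψ.dT rψ
  have nI₁ := null_mul_divC hK hKpos gu (rρh.mul ru.dT.dR) (rρh.mul ru.dT.dZ)
  have nI₂ := (null_mul_divC hK hKpos gu (rρ.mul (rv.mul rψ.dR).dT)
    (rρ.mul (rv.mul rψ.dZ).dT)).smul (-1)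
  -- terms of the vorticity equation tested with `-R u`
  have n₁ := (null_mul_pb hK hKpos gu rQ₁ rρh).smul (-(1 / 2))
  have n₂ := (null_mul_pb hK hKpos gu ((rρh.mul rr2).mul ru.LapPol) ru).smul (-1)
  have n₃ := (null_mul_pb hK hKpos gu rp rr2).smul (-1)
  have n₄ := null_mul_pb hK hKpos gu rψ.GS rψ
  have n₅ := (null_mul_dP hK hKpos gu rψ.GS).smul F0
  have n₆ := (null_mul_pb hK hKpos gu ((rρ.mul (rv.pow 2)).mul rψ.GS) rψ).smul (-1)
  have n₇ := (null_mul_pb hK hKpos gu ((rρ.mul rv).mul (rv.gdot rψ)) rψ).smul (-1)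
  have n₈ := null_mul_divC hK hKpos gu (((rρh.mul (rF 2 F0)).mul rv).mul ru.dP.dR)
    (((rρh.mul (rF 2 F0)).mul rv).mul ru.dP.dZ)
  have n₉ := null_mul_pb hK hKpos gu rQ₃ rρh
  have n₁₀ := (null_mul_pb hK hKpos gu rρh ((rv.pow 2).mul rψ.Bpol2)).smul (1 / 2)
  have n₁₁ := null_mul_pb hK hKpos gu ((rρh.mul rv).mul ru.LapPol) rψ
  have n₁₂ := null_mul_pb hK hKpos gu ((rρh.mul rv).mul rψ.GS) ru
  have n₁₃ := null_mul_pb hK hKpos gu (rρh.mul (rψ.gdot rv)) ru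
  have n₁₄ := (null_mul_dZ hK hKpos gu
    (((rρh.mul (rF 3 F0)).mul rv).mul (rv.mul rψ.dZ).dP)).smul (-1)
  have n₁₅ := (null_mul_dR hK hKpos gu
    (((rρh.mul (rF 3 F0)).mul rv).mul (rv.mul rψ.dR).dP)).smul (-1)
  have n₁₆ := null_mul_dZ hK hKpos gu ((rρh.mul (rF 3 (F0 ^ 2))).mul (rv.pow 2))
  -- transport of the kinetic energy
  have n₁₇ := null_mul_pb hK hKpos gh rQ₂ ru
  have n₁₈ := (null_mul_dP hK hKpos gρv rQ₁).smul (-F0 / 2)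
  have n₁₉ := (null_mul_dP hK hKpos gρv rQ₂).smul (-F0)
  have n₂₀ := (null_mul_dP hK hKpos gρv rQ₃).smul F0
  have n₂₁ := (null_mul_pb hK hKpos gρv rQ₁ rψ).smul (-(1 / 2))
  have n₂₂ := (null_mul_pb hK hKpos gρv rQ₂ rψ).smul (-1)
  have n₂₃ := null_mul_pb hK hKpos gρv rQ₃ rψ
  -- internal energy
  have n₂₄ := (null_mul_pb hK hKpos gp rr2 ru).smul (1 / (γ - 1))
  have n₂₅ := (null_mul_pb hK hKpos gp rv rψ).smul (-(1 / (γ - 1) + 1))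
  have n₂₆ := (null_mul_dP hK hKpos gp rv).smul (-F0 * (1 / (γ - 1) + 1))
  refine integral_const_of_null hK hKpos gE
    (((nM.add (nI₁.add nI₂)).add ((((n₁.add n₂).add (n₃.add n₄)).add ((n₅.add n₆).add
      (n₇.add n₈))).add (((n₉.add n₁₀).add (n₁₁.add n₁₂)).add ((n₁₃.add n₁₄).add
      (n₁₅.add n₁₆))))).add ((((n₁₇.add n₁₈).add (n₁₉.add n₂₀)).add ((n₂₁.add n₂₂).add n₂₃)).add
      (n₂₄.add (n₂₅.add n₂₆))) |>.congr hK fun t R φ Z hq => ?_)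
  have hR : 0 < R := hKpos _ hq
  clear nM nI₁ nI₂ n₁ n₂ n₃ n₄ n₅ n₆ n₇ n₈ n₉ n₁₀ n₁₁ n₁₂ n₁₃ n₁₄ n₁₅ n₁₆ n₁₇ n₁₈ n₁₉ n₂₀ n₂₁ n₂₂
    n₂₃ n₂₄ n₂₅ n₂₆
  rw [dT_Edens_mul_radius γ F0 rψ ru rρ rp rv hR]
  have e₁ := hi t R φ Z hR
  have e₂ := hii t R φ Z hR
  have e₃ := hiii t R φ Z hR
  have e₄ := hiv t R φ Z hR
  have e₅ := hv t R φ Z hR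
  clear hi hii hiii hiv hv
  have vB : B2 F0 ψ t R φ Z
      = (F0 ^ 2 + (dR ψ t R φ Z) ^ 2 + (dZ ψ t R φ Z) ^ 2) / R ^ 2 := rfl
  have vBp : Bpol2 ψ t R φ Z = ((dR ψ t R φ Z) ^ 2 + (dZ ψ t R φ Z) ^ 2) / R ^ 2 := rfl
  have vrh : rh ρ t R φ Z = R ^ 2 * ρ t R φ Z := rfl
  have vgu : gradu2 u t R φ Z = (dR u t R φ Z) ^ 2 + (dZ u t R φ Z) ^ 2 := rfl
  have vgdot (f g : F4) : gdot f g t R φ Z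
      = dR f t R φ Z * dR g t R φ Z + dZ f t R φ Z * dZ g t R φ Z := rfl
  have vpb (f g : F4) : pb f g t R φ Z
      = dR f t R φ Z * dZ g t R φ Z - dZ f t R φ Z * dR g t R φ Z := rfl
  simp only [vpb, dR_radius_sq, dZ_radius_sq, dR_rh rρ hR, dZ_rh rρ hR,
    dR_div_const, dZ_div_const, dR_sq_mul rv (rψ.B2 F0) hR, dZ_sq_mul rv (rψ.B2 F0) hR,
    dR_sq_mul rv rψ.Bpol2 hR, dZ_sq_mul rv rψ.Bpol2 hR,
    dR_mul rv (rψ.gdot ru) hR, dZ_mul rv (rψ.gdot ru) hR, dP_mul rv (rψ.gdot ru) hR,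
    dP_mul rv rψ.dR hR, dP_mul rv rψ.dZ hR, dT_mul rv rψ.dR hR, dT_mul rv rψ.dZ hR,
    dR_mul rρ rv hR, dZ_mul rρ rv hR, dP_mul rρ rv hR,
    dP_gdot rψ ru hR, dP_sq_radius_gradu2 ru hR,
    dR_dT rψ hR, dZ_dT rψ hR, dR_dT ru hR, dZ_dT ru hR, dR_dP ru hR, dZ_dP ru hR,
    vgdot, vrh, vgu, vB, vBp] at e₁ e₂ e₃ e₄ e₅ ⊢
  have hR0 : R ≠ 0 := hR.ne'
  have hγ0 : γ - 1 ≠ 0 := by linarith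
  linear_combination (norm := skip) (-(GS ψ t R φ Z / R)) * e₁ - R * u t R φ Z * e₂
    + R * ((R ^ 2 * ((dR u t R φ Z) ^ 2 + (dZ u t R φ Z) ^ 2)
      + vpar t R φ Z ^ 2 * ((F0 ^ 2 + (dR ψ t R φ Z) ^ 2 + (dZ ψ t R φ Z) ^ 2) / R ^ 2)
      - 2 * vpar t R φ Z * (dR ψ t R φ Z * dR u t R φ Z + dZ ψ t R φ Z * dZ u t R φ Z)) / 2) * e₃
    + R / (γ - 1) * e₄ + R * vpar t R φ Z * e₅
  clear e₁ e₂ e₃ e₄ e₅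
  field_simp
  ring
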